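/- arXiv:1407.1479 — 5 statements merged into one kernel-verified Lean document; each statement's English description precedes it below -/
import Mathlib

section
/- Let T > 0, c > 0, and let X : [0,T) → ℝ be C¹ and satisfy the Riccati equation X'(t) = X(t)² − a(t)X(t) − b(t) on [0,T), where a, b : [0,T) → ℝ are continuous with |a(t)| ≤ c and |b(t)| ≤ c for all t ∈ [0,T). If there exists a sequence tₙ ∈ [0,T) with tₙ → T and X(tₙ) → ∞, then X(t) → ∞ as t → T⁻. -/
/-- A level `M` is a lower barrier for `X` on `[s,t]` if the derivative of `X` is positive
wherever `X = M`. -/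
theorem le_of_deriv_pos_at_level {X X' : ℝ → ℝ} {s t M : ℝ} (hst : s ≤ t)
    (hX : ∀ x ∈ Set.Icc s t, HasDerivAt X (X' x) x) (hs : M ≤ X s)
    (hpos : ∀ x ∈ Set.Ico s t, X x = M → 0 < X' x) : M ≤ X t := by
  have h := image_le_of_deriv_right_lt_deriv_boundary
    (f := fun x => -X x) (f' := fun x => -X' x) (B := fun _ => -M) (B' := fun _ => 0)
    (fun x hx => (hX x hx).continuousAt.neg.continuousWithinAt)
    (fun x hx => (hX x (Set.Ico_subset_Icc_self hx)).neg.hasDerivWithinAt)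
    (neg_le_neg hs) (fun x => hasDerivAt_const x (-M))
    (fun x hx hxM => neg_lt_zero.mpr (hpos x hx (neg_injective hxM)))
    (Set.right_mem_Icc.mpr hst)
  exact neg_le_neg_iff.mp h

/-- For a `C¹` solution of the Riccati equation `X' = X² - aX - b` on `[0,T)` with
continuous coefficients bounded by `c`, blow-up along a sequence `tₙ → T` forces
`X(t) → ∞` as `t → T⁻`. -/
theorem riccati_blowup_along_sequence_implies_limit
    (T c : ℝ) (hT : 0 < T) (hc : 0 < c)
    (X a b : ℝ → ℝ)
    (ha : ContinuousOn a (Set.Ico 0 T)) (hb : ContinuousOn b (Set.Ico 0 T))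
    (haB : ∀ t ∈ Set.Ico (0 : ℝ) T, |a t| ≤ c)
    (hbB : ∀ t ∈ Set.Ico (0 : ℝ) T, |b t| ≤ c)
    (hX : ∀ t ∈ Set.Ico (0 : ℝ) T,
      HasDerivAt X ((X t) ^ 2 - a t * X t - b t) t)
    (tn : ℕ → ℝ) (htn : ∀ n, tn n ∈ Set.Ico (0 : ℝ) T)
    (htnT : Filter.Tendsto tn Filter.atTop (nhds T))
    (hXtn : Filter.Tendsto (fun n => X (tn n)) Filter.atTop Filter.atTop) :
    Filter.Tendsto X (nhdsWithin T (Set.Iio T)) Filter.atTop := by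
  rw [Filter.tendsto_atTop]
  intro K
  obtain ⟨M, hKM, hcM⟩ : ∃ M, K ≤ M ∧ c + 1 ≤ M :=
    ⟨max K (c + 1), le_max_left _ _, le_max_right _ _⟩
  obtain ⟨n, hn⟩ := (hXtn.eventually_ge_atTop M).exists
  filter_upwards [Ioo_mem_nhdsLT (htn n).2] with t ht
  have hmem : ∀ x ∈ Set.Icc (tn n) t, x ∈ Set.Ico (0 : ℝ) T := fun x hx =>
    ⟨(htn n).1.trans hx.1, hx.2.trans_lt ht.2⟩
  refine hKM.trans (le_of_deriv_pos_at_level ht.1.le (fun x hx => hX x (hmem x hx)) hn ?_)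
  intro x hx hxM
  have hx' := hmem x (Set.Ico_subset_Icc_self hx)
  have hax := (abs_le.mp (haB x hx')).2
  have hbx := (abs_le.mp (hbB x hx')).2
  rw [hxM]
  nlinarith [mul_nonneg (sub_nonneg.mpr hax) (show 0 ≤ M by linarith),
    mul_nonneg (sub_nonneg.mpr hcM) (show 0 ≤ M by linarith)]
end

section
/- Let T > 0, c > 0, and let X : [0,T) → ℝ be C¹ and satisfy the Riccati equation X'(t) = X(t)² − a(t)X(t) − b(t) on [0,T), where a, b : [0,T) → ℝ are continuous with |a(t)| ≤ c and |b(t)| ≤ c for all t ∈ [0,T). If X(t) → ∞ as t → T⁻, then lim_{t→T⁻} (T − t) · X(t) = 1. -/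
/-- Precise blow-up rate: a blowing-up `C¹` solution of the Riccati equation
`X' = X² - aX - b` on `[0,T)` with bounded continuous coefficients satisfies
`(T - t) X(t) → 1` as `t → T⁻`. -/
theorem riccati_blowup_rate
    (T c : ℝ) (hT : 0 < T) (hc : 0 < c)
    (X a b : ℝ → ℝ)
    (ha : ContinuousOn a (Set.Ico 0 T)) (hb : ContinuousOn b (Set.Ico 0 T))
    (haB : ∀ t ∈ Set.Ico (0 : ℝ) T, |a t| ≤ c)
    (hbB : ∀ t ∈ Set.Ico (0 : ℝ) T, |b t| ≤ c)
    (hX : ∀ t ∈ Set.Ico (0 : ℝ) T,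
      HasDerivAt X ((X t) ^ 2 - a t * X t - b t) t)
    (hblow : Filter.Tendsto X (nhdsWithin T (Set.Iio T)) Filter.atTop) :
    Filter.Tendsto (fun t => (T - t) * X t) (nhdsWithin T (Set.Iio T)) (nhds 1) := by
  have hmem : ∀ᶠ t in nhdsWithin T (Set.Iio T), t ∈ Set.Ico 0 T := Ico_mem_nhdsLT hT
  have hpos : ∀ᶠ t in nhdsWithin T (Set.Iio T), 0 < X t := hblow.eventually_gt_atTop 0
  have hinv : Filter.Tendsto (fun t => (X t)⁻¹) (nhdsWithin T (Set.Iio T)) (nhds 0) :=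
    tendsto_inv_atTop_zero.comp hblow
  have hbdd : ∀ f : ℝ → ℝ, (∀ t ∈ Set.Ico (0 : ℝ) T, |f t| ≤ c) →
      Filter.IsBoundedUnder (· ≤ ·) (nhdsWithin T (Set.Iio T)) (norm ∘ f) := fun f hf =>
    Filter.isBoundedUnder_of_eventually_le (hmem.mono hf)
  have hderiv : Filter.Tendsto (fun t => -((X t) ^ 2 - a t * X t - b t) / (X t) ^ 2 / (-1))
      (nhdsWithin T (Set.Iio T)) (nhds 1) := by
    have h := (tendsto_const_nhds (x := (1 : ℝ))).sub
      (hinv.zero_mul_isBoundedUnder_le (hbdd a haB)) |>.sub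
      ((by simpa using hinv.mul hinv :
        Filter.Tendsto (fun t => (X t)⁻¹ * (X t)⁻¹) (nhdsWithin T (Set.Iio T))
          (nhds 0)).zero_mul_isBoundedUnder_le (hbdd b hbB))
    simp only [sub_zero] at h
    refine h.congr' ?_
    filter_upwards [hpos] with t ht
    field_simp
  have hquot : Filter.Tendsto (fun t => (X t)⁻¹ / (T - t))
      (nhdsWithin T (Set.Iio T)) (nhds 1) := by
    refine HasDerivAt.lhopital_zero_nhdsLT (g' := fun _ => -1) ?_ ?_ ?_ hinv ?_ hderiv
    · filter_upwards [hmem, hpos] with t ht hXt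
      exact (hX t ht).inv hXt.ne'
    · exact .of_forall fun t => (hasDerivAt_id t).const_sub T
    · simp
    · have h : Filter.Tendsto (fun t => T - t) (nhds T) (nhds (T - T)) :=
        tendsto_const_nhds.sub Filter.tendsto_id
      rw [sub_self] at h
      exact h.mono_left nhdsWithin_le_nhds
  simpa [inv_div, div_inv_eq_mul] using hquot.inv₀ one_ne_zero
end

section
/- Let t₀ < T, c > 0, 0 < ε < 1, and let X : [t₀,T) → ℝ be C¹ and satisfy the Riccati equation X'(t) = X(t)² − a(t)X(t) − b(t) on [t₀,T), where a, b : [t₀,T) → ℝ are continuous with |a(t)| ≤ c and |b(t)| ≤ c for all t. If X(t) ≥ max(1, 2c/ε) for all t ∈ [t₀,T), then X(t) ≤ 1/((1 − ε)(T − t)) for all t ∈ [t₀,T). -/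
/-- If `X` is at least `max 1 (2c/ε)` and `|a|, |b| ≤ c`, then the slope of `1/X` along
`X' = X² - aX - b` is at most `-(1 - ε)`. -/
lemma riccati_inv_slope_le {c ε x a b : ℝ} (hc : 0 < c) (hε : 0 < ε)
    (ha : |a| ≤ c) (hb : |b| ≤ c) (hx : max 1 (2 * c / ε) ≤ x) :
    -(x ^ 2 - a * x - b) / x ^ 2 ≤ -(1 - ε) := by
  obtain ⟨hx1, hxc⟩ := max_le_iff.1 hx
  have hcx : 2 * c ≤ x * ε := (div_le_iff₀ hε).1 hxc
  have hx0 : 0 < x := by linarith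
  have hax : a * x ≤ c * x := mul_le_mul_of_nonneg_right (le_of_abs_le ha) hx0.le
  have hbx : b ≤ c * x := (le_of_abs_le hb).trans (le_mul_of_one_le_right hc.le hx1)
  rw [div_le_iff₀ (by positivity)]
  nlinarith [mul_le_mul_of_nonneg_right hcx hx0.le]


/-- Uniform upper bound: a solution of the Riccati equation `X' = X² - aX - b`
on `[t₀,T)` with coefficients bounded by `c`, which is pointwise at least
`max(1, 2c/ε)`, satisfies `X(t) ≤ 1/((1-ε)(T-t))`. -/
theorem riccati_upper_bound
    (t₀ T c ε : ℝ) (ht : t₀ < T) (hc : 0 < c) (hε0 : 0 < ε) (hε1 : ε < 1)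
    (X a b : ℝ → ℝ)
    (ha : ContinuousOn a (Set.Ico t₀ T)) (hb : ContinuousOn b (Set.Ico t₀ T))
    (haB : ∀ t ∈ Set.Ico t₀ T, |a t| ≤ c)
    (hbB : ∀ t ∈ Set.Ico t₀ T, |b t| ≤ c)
    (hX : ∀ t ∈ Set.Ico t₀ T,
      HasDerivAt X ((X t) ^ 2 - a t * X t - b t) t)
    (hlow : ∀ t ∈ Set.Ico t₀ T, max 1 (2 * c / ε) ≤ X t) :
    ∀ t ∈ Set.Ico t₀ T, X t ≤ 1 / ((1 - ε) * (T - t)) := by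
  have hpos : ∀ s ∈ Set.Ico t₀ T, 0 < X s := fun s hs =>
    one_pos.trans_le ((le_max_left _ _).trans (hlow s hs))
  have hinv : ∀ s ∈ Set.Ico t₀ T,
      HasDerivAt (fun u => (X u)⁻¹) (-((X s) ^ 2 - a s * X s - b s) / (X s) ^ 2) s :=
    fun s hs => (hX s hs).fun_inv (hpos s hs).ne'
  intro t htT
  have hk : 0 < 1 - ε := sub_pos.2 hε1
  have hdecr : ∀ s ∈ Set.Ico t T, (X s)⁻¹ - (X t)⁻¹ ≤ -(1 - ε) * (s - t) := fun s hs =>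
    (convex_Ico t₀ T).image_sub_le_mul_sub_of_deriv_le
      (fun u hu => (hinv u hu).continuousAt.continuousWithinAt)
      (fun u hu => (hinv u (interior_subset hu)).differentiableAt.differentiableWithinAt)
      (fun u hu => by
        have hu' := interior_subset hu
        rw [(hinv u hu').deriv]
        exact riccati_inv_slope_le hc hε0 (haB u hu') (hbB u hu') (hlow u hu'))
      t htT s ⟨htT.1.trans hs.1, hs.2⟩ hs.1
  have hT : T ≤ t + (X t)⁻¹ / (1 - ε) := by
    refine le_of_forall_lt_imp_le_of_dense fun s hs => ?_
    rw [← sub_le_iff_le_add', le_div_iff₀ hk]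
    have hXt := inv_pos.2 (hpos t htT)
    rcases le_total t s with hts | hst
    · have hXs := inv_pos.2 (hpos s ⟨htT.1.trans hts, hs⟩)
      linarith [hdecr s ⟨hts, hs⟩]
    · nlinarith
  rw [← sub_le_iff_le_add', le_div_iff₀ hk, mul_comm] at hT
  rw [one_div]
  exact (le_inv_comm₀ (mul_pos hk (sub_pos.2 htT.2)) (hpos t htT)).1 hT
end

section
/- Let t₀ < T, c > 0, 0 < ε ≤ 1/2, and let X : [t₀,T) → ℝ be C¹ and satisfy the Riccati equation X'(t) = X(t)² − a(t)X(t) − b(t) on [t₀,T), where a, b : [t₀,T) → ℝ are continuous with |a(t)| ≤ c and |b(t)| ≤ c for all t. Suppose (1 − ε)/(T − t) ≤ X(t) for all t ∈ [t₀,T), and that T − t₀ ≤ min(1, 1/(6c)). Then X(t) ≤ (1 + 6c(T − t))/(T − t) for all t ∈ [t₀,T). -/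
/-- Refined upper bound: a solution of the Riccati equation `X' = X² - aX - b`
on `[t₀,T)` with coefficients bounded by `c` and lower bound
`(1-ε)/(T-t) ≤ X(t)`, for `T - t₀ ≤ min(1, 1/(6c))`, satisfies
`X(t) ≤ (1 + 6c(T-t))/(T-t)`. -/
theorem riccati_refined_upper_bound
    (t₀ T c ε : ℝ) (ht : t₀ < T) (hc : 0 < c) (hε0 : 0 < ε) (hε1 : ε ≤ 1 / 2)
    (X a b : ℝ → ℝ)
    (ha : ContinuousOn a (Set.Ico t₀ T)) (hb : ContinuousOn b (Set.Ico t₀ T))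
    (haB : ∀ t ∈ Set.Ico t₀ T, |a t| ≤ c)
    (hbB : ∀ t ∈ Set.Ico t₀ T, |b t| ≤ c)
    (hX : ∀ t ∈ Set.Ico t₀ T,
      HasDerivAt X ((X t) ^ 2 - a t * X t - b t) t)
    (hlow : ∀ t ∈ Set.Ico t₀ T, (1 - ε) / (T - t) ≤ X t)
    (hshort : T - t₀ ≤ min 1 (1 / (6 * c))) :
    ∀ t ∈ Set.Ico t₀ T, X t ≤ (1 + 6 * c * (T - t)) / (T - t) := by
  have hpos : ∀ t ∈ Set.Ico t₀ T, 0 < X t := fun t h =>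
    lt_of_lt_of_le (div_pos (by linarith) (by linarith [h.2])) (hlow t h)
  have hinv : ∀ t ∈ Set.Ico t₀ T, (X t)⁻¹ ≤ 2 * (T - t) := by
    intro t h
    have hs : 0 < T - t := by linarith [h.2]
    have h1 := hlow t h
    rw [div_le_iff₀ hs] at h1
    rw [inv_le_iff_one_le_mul₀ (hpos t h)]
    nlinarith
  set G : ℝ → ℝ := fun t => (X t)⁻¹ - (T - t) + c * (T - t) ^ 2 + 4 / 3 * c * (T - t) ^ 3 with hG
  have hderiv : ∀ t ∈ Set.Ico t₀ T, HasDerivAt G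
      (a t * (X t)⁻¹ + b t * (X t)⁻¹ ^ 2 - 2 * c * (T - t) - 4 * c * (T - t) ^ 2) t := by
    intro t h
    have hne := (hpos t h).ne'
    have hs : HasDerivAt (fun t => T - t) (-1) t := by
      simpa using (hasDerivAt_id t).const_sub T
    refine HasDerivAt.congr_deriv (((((hX t h).inv hne).sub hs).add ((hs.pow 2).const_mul c)).add
      ((hs.pow 3).const_mul (4 / 3 * c))) ?_
    push_cast
    field_simp
    ring
  have hanti : AntitoneOn G (Set.Ico t₀ T) := by
    apply antitoneOn_of_deriv_nonpos (convex_Ico t₀ T)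
    · exact fun t h => (hderiv t h).continuousAt.continuousWithinAt
    · exact fun t h =>
        (hderiv t (interior_subset h)).differentiableAt.differentiableWithinAt
    · intro t h
      replace h := interior_subset h
      rw [(hderiv t h).deriv]
      have hy := inv_pos.2 (hpos t h)
      have hy2 := hinv t h
      have h1 : a t * (X t)⁻¹ ≤ c * (2 * (T - t)) :=
        mul_le_mul (le_of_abs_le (haB t h)) hy2 hy.le hc.le
      have h2 : b t * (X t)⁻¹ ^ 2 ≤ c * (2 * (T - t)) ^ 2 :=
        mul_le_mul (le_of_abs_le (hbB t h)) (pow_le_pow_left₀ hy.le hy2 2) (by positivity) hc.le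
      linarith
  intro t h
  have hs : 0 < T - t := by linarith [h.2]
  have hGt : 0 ≤ G t := by
    by_contra! hneg
    have hr : max t (T + G t / 2) ∈ Set.Ico t₀ T :=
      ⟨h.1.trans (le_max_left _ _), max_lt h.2 (by linarith)⟩
    have h1 := hanti h hr (le_max_left _ _)
    have h2 := le_max_right t (T + G t / 2)
    set r := max t (T + G t / 2)
    have h3 : -(T - r) ≤ G r := by
      have hy := inv_pos.2 (hpos r hr)
      have hsr : 0 ≤ T - r := by linarith [hr.2]
      have h4 : 0 ≤ c * (T - r) ^ 2 := by positivity
      have h5 : 0 ≤ 4 / 3 * c * (T - r) ^ 3 := by positivity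
      simp only [hG]
      linarith
    linarith
  simp only [hG] at hGt
  have hs1 : T - t ≤ 1 := by linarith [h.1, hshort.trans (min_le_left _ _)]
  have hcs : c * (T - t) ≤ 1 / 6 := by
    have h1 : T - t ≤ 1 / (6 * c) := by linarith [h.1, hshort.trans (min_le_right _ _)]
    rw [le_div_iff₀ (by positivity)] at h1
    linarith
  set s := T - t
  have hu : 0 < c * s := by positivity
  have hlower : s * (1 - 7 / 3 * (c * s)) ≤ (X t)⁻¹ := by
    have h1 : c * s ^ 3 ≤ c * s ^ 2 :=
      mul_le_mul_of_nonneg_left (pow_le_pow_of_le_one hs.le hs1 (by norm_num)) hc.le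
    linarith
  have hXs : X t * s * (1 - 7 / 3 * (c * s)) ≤ 1 := by
    have h1 := mul_le_mul_of_nonneg_left hlower (hpos t h).le
    rw [mul_inv_cancel₀ (hpos t h).ne'] at h1
    linarith
  rw [le_div_iff₀ hs]
  have hprod : 1 ≤ (1 + 6 * (c * s)) * (1 - 7 / 3 * (c * s)) := by nlinarith
  have hfac : 0 < 1 - 7 / 3 * (c * s) := by linarith
  have hfinal := le_of_mul_le_mul_right (hXs.trans hprod) hfac
  linarith
end

section
/- Let t₁ < T and a, b, k ≥ 0, and let y : [t₁,T) → ℝ be differentiable with y(t) ≥ 0 and y'(t) ≥ −(a + b/√(T − t) + k/(T − t)) y(t) for all t ∈ [t₁,T). Then y(t) ≥ y(t₁) e^{−a(T − t₁) − 2b√(T − t₁)} ((T − t)/(T − t₁))^k for all t ∈ [t₁,T). -/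
/-- An antiderivative of the Gronwall coefficient `a + b/√(T-t) + k/(T-t)` on `(-∞, T)`. -/
theorem hasDerivAt_sqrt_log_exponent {T a b k t : ℝ} (ht : t < T) :
    HasDerivAt (fun s => a * s - 2 * b * Real.sqrt (T - s) - k * Real.log (T - s))
      (a + b / Real.sqrt (T - t) + k / (T - t)) t := by
  have hne : T - t ≠ 0 := (sub_pos.2 ht).ne'
  have hsqrt : Real.sqrt (T - t) ≠ 0 := (Real.sqrt_pos.2 (sub_pos.2 ht)).ne'
  have hsub : HasDerivAt (fun s => T - s) (-1) t := (hasDerivAt_id t).const_sub T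
  refine ((((hasDerivAt_id t).const_mul a).sub ((hsub.sqrt hne).const_mul (2 * b))).sub
    ((hsub.log hne).const_mul k)).congr_deriv ?_
  field_simp
  ring

/-- If `φ' = c` and `y' ≥ -c y` on `[t₁,T)`, then the product `y e^φ` is nondecreasing there. -/
theorem monotoneOn_mul_exp_of_neg_mul_le_deriv {t₁ T : ℝ} {y y' φ c : ℝ → ℝ}
    (hy : ∀ t ∈ Set.Ico t₁ T, HasDerivAt y (y' t) t)
    (hφ : ∀ t ∈ Set.Ico t₁ T, HasDerivAt φ (c t) t)
    (hineq : ∀ t ∈ Set.Ico t₁ T, -c t * y t ≤ y' t) :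
    MonotoneOn (fun t => y t * Real.exp (φ t)) (Set.Ico t₁ T) := by
  have hderiv : ∀ t ∈ Set.Ico t₁ T, HasDerivAt (fun t => y t * Real.exp (φ t))
      (y' t * Real.exp (φ t) + y t * (Real.exp (φ t) * c t)) t :=
    fun t ht => (hy t ht).mul (hφ t ht).exp
  refine monotoneOn_of_hasDerivWithinAt_nonneg (convex_Ico t₁ T)
    (fun t ht => (hderiv t ht).continuousAt.continuousWithinAt)
    (fun t ht => (hderiv t (interior_subset ht)).hasDerivWithinAt) fun t ht => ?_
  have h := hineq t (interior_subset ht)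
  have hnonneg : 0 ≤ (y' t + c t * y t) * Real.exp (φ t) :=
    mul_nonneg (by linarith) (Real.exp_pos _).le
  linarith

/-- Gronwall inequality with an integrable square-root singularity and a
critical `1/(T-t)` term: if `y ≥ 0` satisfies
`y' ≥ -(a + b/√(T-t) + k/(T-t)) y` on `[t₁,T)`, then
`y(t) ≥ y(t₁) e^{-a(T-t₁) - 2b√(T-t₁)} ((T-t)/(T-t₁))^k`. -/
theorem singular_gronwall_sqrt
    (t₁ T a b k : ℝ) (ht : t₁ < T) (ha : 0 ≤ a) (hb : 0 ≤ b) (hk : 0 ≤ k)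
    (y y' : ℝ → ℝ)
    (hderiv : ∀ t ∈ Set.Ico t₁ T, HasDerivAt y (y' t) t)
    (hpos : ∀ t ∈ Set.Ico t₁ T, 0 ≤ y t)
    (hineq : ∀ t ∈ Set.Ico t₁ T,
      -(a + b / Real.sqrt (T - t) + k / (T - t)) * y t ≤ y' t) :
    ∀ t ∈ Set.Ico t₁ T,
      y t₁ * Real.exp (-a * (T - t₁) - 2 * b * Real.sqrt (T - t₁)) *
        ((T - t) / (T - t₁)) ^ k ≤ y t := by
  intro t htmem
  have hpos₁ : 0 < T - t₁ := sub_pos.2 ht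
  have hpos_t : 0 < T - t := sub_pos.2 htmem.2
  have hmem : t₁ ∈ Set.Ico t₁ T := ⟨le_rfl, ht⟩
  have hmono := monotoneOn_mul_exp_of_neg_mul_le_deriv hderiv
    (fun s hs => hasDerivAt_sqrt_log_exponent (a := a) (b := b) (k := k) hs.2) hineq
    hmem htmem htmem.1
  rw [Real.rpow_def_of_pos (div_pos hpos_t hpos₁), mul_assoc, ← Real.exp_add,
    Real.log_div hpos_t.ne' hpos₁.ne']
  refine le_of_mul_le_mul_right (le_trans ?_ hmono)
    (Real.exp_pos (a * t - 2 * b * Real.sqrt (T - t) - k * Real.log (T - t)))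
  rw [mul_assoc, ← Real.exp_add]
  refine mul_le_mul_of_nonneg_left (Real.exp_le_exp.2 ?_) (hpos t₁ hmem)
  have hlin : 0 ≤ a * (T - t) := mul_nonneg ha hpos_t.le
  have hsqrt : 0 ≤ b * Real.sqrt (T - t) := mul_nonneg hb (Real.sqrt_nonneg _)
  linarith
end
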